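/- For every integer t ≥ 4, the intersection of the cyclic subgroups ⟨a⟩ and ⟨b·a⟩ of M_{2^t} equals the cyclic subgroup ⟨a²⟩ generated by a², i.e. the set of even powers of a, which has exactly 2^(t-2) elements. -/

import Mathlib

/-- The multiplier `2^(t-2)+1` squares to `1` modulo `2^(t-1)` when `t ≥ 3`. -/
lemma Mmod.key (t : ℕ) (ht : 3 ≤ t) :
    ((2 ^ (t - 2) + 1 : ZMod (2 ^ (t - 1))) * (2 ^ (t - 2) + 1)) = 1 := by
  obtain ⟨s, rfl⟩ := Nat.exists_eq_add_of_le ht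
  have h2 : 3 + s - 2 = s + 1 := by omega
  have h3 : 3 + s - 1 = s + 2 := by omega
  rw [h2, h3]
  have h0 : ((2 ^ (s + 2) : ℕ) : ZMod (2 ^ (s + 2))) = 0 := ZMod.natCast_self _
  push_cast at h0
  linear_combination ((2 : ZMod (2 ^ (s + 2))) ^ s + 1) * h0

/-- The automorphism of `Multiplicative (ZMod (2^(t-1)))` given by multiplication of the
exponent by `2^(t-2)+1`. -/
def Mmod.uAut (t : ℕ) (ht : 3 ≤ t) :
    MulAut (Multiplicative (ZMod (2 ^ (t - 1)))) where
  toFun x := Multiplicative.ofAdd ((2 ^ (t - 2) + 1) * x.toAdd)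
  invFun x := Multiplicative.ofAdd ((2 ^ (t - 2) + 1) * x.toAdd)
  left_inv x := by
    simp only [toAdd_ofAdd, ← mul_assoc, Mmod.key t ht, one_mul,
      ofAdd_toAdd]
  right_inv x := by
    simp only [toAdd_ofAdd, ← mul_assoc, Mmod.key t ht, one_mul,
      ofAdd_toAdd]
  map_mul' x y := by
    simp only [toAdd_mul, mul_add, ofAdd_add]

lemma Mmod.uAut_sq (t : ℕ) (ht : 3 ≤ t) : (Mmod.uAut t ht) ^ 2 = 1 := by
  rw [pow_two]
  ext x
  show (Mmod.uAut t ht) ((Mmod.uAut t ht) x) = x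
  show Multiplicative.ofAdd ((2 ^ (t - 2) + 1) *
    (Multiplicative.ofAdd ((2 ^ (t - 2) + 1) * x.toAdd)).toAdd) = x
  simp only [toAdd_ofAdd, ← mul_assoc, Mmod.key t ht, one_mul,
    ofAdd_toAdd]

/-- The action of `ZMod 2` on `ZMod (2^(t-1))` by multiplication by `2^(t-2)+1`. -/
def Mmod.phi (t : ℕ) (ht : 3 ≤ t) :
    Multiplicative (ZMod 2) →* MulAut (Multiplicative (ZMod (2 ^ (t - 1)))) where
  toFun g := (Mmod.uAut t ht) ^ (g.toAdd.val)
  map_one' := by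
    show (Mmod.uAut t ht) ^ ((0 : ZMod 2).val) = 1
    simp
  map_mul' := fun g h => by
    show (Mmod.uAut t ht) ^ ((g.toAdd + h.toAdd).val) =
      (Mmod.uAut t ht) ^ (g.toAdd.val) * (Mmod.uAut t ht) ^ (h.toAdd.val)
    rw [ZMod.val_add, ← pow_eq_pow_mod _ (Mmod.uAut_sq t ht), pow_add]

/-- The modular maximal-cyclic group `M_{2^t}`, realized as the semidirect product
`(ZMod 2^(t-1)) ⋊ (ZMod 2)` where the nontrivial element of `ZMod 2` acts by
multiplication by `2^(t-2)+1`. -/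
abbrev Mmod (t : ℕ) (ht : 3 ≤ t) :=
  SemidirectProduct (Multiplicative (ZMod (2 ^ (t - 1)))) (Multiplicative (ZMod 2))
    (Mmod.phi t ht)

/-- The generator `a` of `M_{2^t}`. -/
def Mmod.a (t : ℕ) (ht : 3 ≤ t) : Mmod t ht :=
  SemidirectProduct.inl (Multiplicative.ofAdd (1 : ZMod (2 ^ (t - 1))))

/-- The generator `b` of `M_{2^t}`. -/
def Mmod.b (t : ℕ) (ht : 3 ≤ t) : Mmod t ht :=
  SemidirectProduct.inr (Multiplicative.ofAdd (1 : ZMod 2))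


lemma Mmod.orderOf_a (t : ℕ) (ht : 3 ≤ t) : orderOf (Mmod.a t ht) = 2 ^ (t - 1) := by
  rw [Mmod.a, orderOf_injective _ SemidirectProduct.inl_injective, orderOf_ofAdd_eq_addOrderOf,
    ZMod.addOrderOf_one]

lemma Mmod.orderOf_a_sq (t : ℕ) (ht : 3 ≤ t) : orderOf (Mmod.a t ht ^ 2) = 2 ^ (t - 2) := by
  have hpow : 2 ^ (t - 1) = 2 ^ (t - 2) * 2 := by
    rw [← pow_succ]
    congr 1
    omega
  rw [orderOf_pow_of_dvd two_ne_zero (by rw [Mmod.orderOf_a, hpow]; exact dvd_mul_left _ _),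
    Mmod.orderOf_a, hpow, Nat.mul_div_cancel _ two_pos]

lemma Mmod.a_pow (t : ℕ) (ht : 3 ≤ t) (n : ℕ) :
    Mmod.a t ht ^ n = SemidirectProduct.inl (Multiplicative.ofAdd (n : ZMod (2 ^ (t - 1)))) := by
  rw [Mmod.a, ← map_pow, ← ofAdd_nsmul, nsmul_one]

lemma Mmod.b_mul_a_sq (t : ℕ) (ht : 3 ≤ t) :
    (Mmod.b t ht * Mmod.a t ht) ^ 2 = (Mmod.a t ht ^ 2) ^ (2 ^ (t - 3) + 1) := by
  have hb : Mmod.b t ht * Mmod.b t ht = 1 := by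
    rw [Mmod.b, ← map_mul, ← ofAdd_add, CharTwo.add_self_eq_zero, ofAdd_zero, map_one]
  have hinv : (Mmod.b t ht)⁻¹ = Mmod.b t ht := inv_eq_of_mul_eq_one_left hb
  have hconj : Mmod.b t ht * Mmod.a t ht * Mmod.b t ht = Mmod.a t ht ^ (2 ^ (t - 2) + 1) := by
    have h := SemidirectProduct.inl_aut (φ := Mmod.phi t ht) (Multiplicative.ofAdd (1 : ZMod 2))
      (Multiplicative.ofAdd (1 : ZMod (2 ^ (t - 1))))
    rw [map_inv] at h
    change _ = Mmod.b t ht * Mmod.a t ht * (Mmod.b t ht)⁻¹ at h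
    rw [hinv] at h
    rw [← h, Mmod.a_pow]
    congr 1
    change (Mmod.uAut t ht ^ (1 : ZMod 2).val) _ = _
    rw [ZMod.val_one, pow_one]
    change Multiplicative.ofAdd ((2 ^ (t - 2) + 1) * (1 : ZMod (2 ^ (t - 1)))) = _
    push_cast
    rw [mul_one]
  have hpow : 2 ^ (t - 2) = 2 * 2 ^ (t - 3) := by
    rw [← pow_succ']
    congr 1
    omega
  rw [pow_two, ← mul_assoc, hconj, ← pow_succ, ← pow_mul, hpow]
  congr 1

lemma Mmod.even_of_b_mul_a_zpow_mem (t : ℕ) (ht : 3 ≤ t) (k : ℤ)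
    (hk : (Mmod.b t ht * Mmod.a t ht) ^ k ∈ Subgroup.zpowers (Mmod.a t ht)) : Even k := by
  obtain ⟨j, hj⟩ := hk
  have h := congrArg SemidirectProduct.rightHom hj
  simp only [map_zpow, map_mul, Mmod.a, Mmod.b, SemidirectProduct.rightHom_inl,
    SemidirectProduct.rightHom_inr, one_zpow, mul_one] at h
  rw [← ofAdd_zsmul, eq_comm, ofAdd_eq_one, zsmul_one] at h
  exact (ZMod.intCast_eq_zero_iff_even).1 h

/-- For every integer `t ≥ 4`, the intersection of the cyclic subgroups `⟨a⟩` and `⟨b*a⟩`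
of `M_{2^t}` equals the cyclic subgroup `⟨a²⟩` generated by `a²` (the set of even powers of
`a`), which has exactly `2^(t-2)` elements. -/
theorem statement9 (t : ℕ) (ht3 : 3 ≤ t) (ht : 4 ≤ t) :
    Subgroup.zpowers (Mmod.a t ht3) ⊓ Subgroup.zpowers (Mmod.b t ht3 * Mmod.a t ht3) =
      Subgroup.zpowers ((Mmod.a t ht3) ^ 2) ∧
    Nat.card (Subgroup.zpowers ((Mmod.a t ht3) ^ 2)) = 2 ^ (t - 2) := by
  refine ⟨le_antisymm ?_ ?_, by rw [Nat.card_zpowers, Mmod.orderOf_a_sq]⟩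
  · rintro _ ⟨hx, k, rfl⟩
    obtain ⟨m, rfl⟩ := (Mmod.even_of_b_mul_a_zpow_mem t ht3 k hx).two_dvd
    change (Mmod.b t ht3 * Mmod.a t ht3) ^ (2 * m) ∈ _
    rw [zpow_mul, zpow_ofNat, Mmod.b_mul_a_sq]
    exact zpow_mem (pow_mem (Subgroup.mem_zpowers _) _) _
  · rw [Subgroup.zpowers_le]
    refine ⟨pow_mem (Subgroup.mem_zpowers _) 2, ?_⟩
    have hodd : Odd (2 ^ (t - 3) + 1) := (even_two.pow_of_ne_zero (by omega)).add_one
    obtain ⟨m, hm⟩ := exists_pow_eq_self_of_coprime (x := Mmod.a t ht3 ^ 2)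
      (n := 2 ^ (t - 3) + 1)
      (by rw [Mmod.orderOf_a_sq]; exact (Nat.coprime_two_right.2 hodd).pow_right _)
    rw [← hm, ← Mmod.b_mul_a_sq]
    exact pow_mem (pow_mem (Subgroup.mem_zpowers _) _) _
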